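/- Suppose the pair (L,σ) is normalised, where L ⊆ V^P is an isotropic subspace free of zero, trivial, and Bell factors. Then for every qubit p ∈ P the connected component of the identity of A(L,σ)_p is contained in the circle group C_z. -/

import Mathlib

/- Common framework: binary stabilizer codes, local unitary/SO(3) automorphism groups. -/

noncomputable section
open scoped Matrix Real ComplexConjugate
open scoped Classical

namespace Stab

/-- The one-qubit phase space `V = 𝔽₂ ⊕ 𝔽₂`, with first coordinate the `z`-component
and second coordinate the `x`-component. -/
abbrev V : Type := ZMod 2 × ZMod 2

/-- The symplectic form on `V`. -/
def omegaV (u v : V) : ZMod 2 := u.1 * v.2 + u.2 * v.1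

/-- The phase space `V^P` over a set of qubits `P`. -/
abbrev QV (P : Type) := P → V

variable {P : Type} [Fintype P] [DecidableEq P]

/-- The direct-sum symplectic form on `V^P`. -/
def omega (u v : QV P) : ZMod 2 := ∑ p, omegaV (u p) (v p)

/-- A subspace `L ⊆ V^P` is isotropic if `ω` vanishes identically on `L × L`. -/
def Isotropic (L : Submodule (ZMod 2) (QV P)) : Prop := ∀ u ∈ L, ∀ v ∈ L, omega u v = 0

/-- Support of a vector of `V^P`. -/
def supp (v : QV P) : Set P := {p | v p ≠ 0}

/-- The basis vector `z_p`. -/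
def zvec (p : P) : QV P := Pi.single p ((1 : ZMod 2), (0 : ZMod 2))

/-- The basis vector `x_p`. -/
def xvec (p : P) : QV P := Pi.single p ((0 : ZMod 2), (1 : ZMod 2))

/-- Restriction (coordinate projection) of a vector to a subset `S ⊆ P`. -/
def restrTo (S : Set P) (v : QV P) : QV P := fun p => if p ∈ S then v p else 0

/-- The coordinate subspace `V^S ⊆ V^P`. -/
def coordSub (S : Set P) : Submodule (ZMod 2) (QV P) where
  carrier := {v | ∀ p ∉ S, v p = 0}
  add_mem' := by intro a b ha hb p hp; simp [Pi.add_apply, ha p hp, hb p hp]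
  zero_mem' := by intro p _; rfl
  smul_mem' := by intro c a ha p hp; simp [Pi.smul_apply, ha p hp]

/-- `L_S := L ∩ V^S`. -/
def LS (L : Submodule (ZMod 2) (QV P)) (S : Set P) : Submodule (ZMod 2) (QV P) :=
  L ⊓ coordSub S

/-- `L` splits as a direct factor on `S`, i.e. `L = L_S × L_{P∖S}`. -/
def SplitsOn (L : Submodule (ZMod 2) (QV P)) (S : Set P) : Prop :=
  ∀ v ∈ L, restrTo S v ∈ L

/-- `L` splits off a zero factor: on some nonempty `S ⊆ P` all vectors of `L` vanish. -/
def HasZeroFactor (L : Submodule (ZMod 2) (QV P)) : Prop :=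
  ∃ S : Set P, S.Nonempty ∧ ∀ v ∈ L, ∀ p ∈ S, v p = 0

/-- The qubit `p` is trivial: `L` splits off a one-dimensional factor on `{p}`. -/
def TrivialQubit (L : Submodule (ZMod 2) (QV P)) (p : P) : Prop :=
  SplitsOn L {p} ∧ ∃ v ∈ L, v ≠ 0 ∧ supp v ⊆ {p}

/-- `L` splits off a trivial factor. -/
def HasTrivialFactor (L : Submodule (ZMod 2) (QV P)) : Prop :=
  ∃ p : P, TrivialQubit L p

/-- `L` splits off a Bell Lagrangian: an indecomposable Lagrangian direct factor on a
two-element set of qubits (all of whose nonzero vectors have full support `{p, q}`). -/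
def HasBellFactor (L : Submodule (ZMod 2) (QV P)) : Prop :=
  ∃ p q : P, p ≠ q ∧ SplitsOn L {p, q} ∧
    ∃ v ∈ L, ∃ w ∈ L, v ≠ w ∧ supp v = {p, q} ∧ supp w = {p, q} ∧ supp (v + w) = {p, q}

/-- The factor `L_S` (for `S` in a partition) is indecomposable. -/
def IndecompWithin (L : Submodule (ZMod 2) (QV P)) (S : Set P) : Prop :=
  ∀ T ⊆ S, SplitsOn L T → T = ∅ ∨ T = S

/-! ### The Hilbert space, Pauli operators and stabilizer codes -/

/-- The state space `ℋ^{⊗P} = (ℂ²)^{⊗P}`, realised concretely as functions on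
computational basis labels. -/
abbrev HP (P : Type) := (P → Fin 2) → ℂ

/-- Operators on `ℋ^{⊗P}` as matrices. -/
abbrev MatP (P : Type) := Matrix (P → Fin 2) (P → Fin 2) ℂ

/-- The tensor (local) operator `⊗_{p} g_p` on `ℋ^{⊗P}`. -/
def locOp (g : P → Matrix (Fin 2) (Fin 2) ℂ) : MatP P :=
  Matrix.of fun u w => ∏ p, g p (u p) (w p)

def sigmaX : Matrix (Fin 2) (Fin 2) ℂ := !![0, 1; 1, 0]
def sigmaY : Matrix (Fin 2) (Fin 2) ℂ := !![0, -Complex.I; Complex.I, 0]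
def sigmaZ : Matrix (Fin 2) (Fin 2) ℂ := !![1, 0; 0, -1]

/-- The one-qubit Pauli operator `Z^a X^b` attached to `(a, b) ∈ V`. -/
def pauliMat (v : V) : Matrix (Fin 2) (Fin 2) ℂ := sigmaZ ^ (v.1 : ZMod 2).val * sigmaX ^ (v.2 : ZMod 2).val

/-- The Pauli (Weyl) operator attached to `v ∈ V^P`. -/
def Wop (v : QV P) : MatP P := locOp fun p => pauliMat (v p)

/-- A group-homomorphic section `σ` over `L` of the projection from the Pauli group
`Ṽ^P` onto `V^P`: each value `σ(v)` is a unitary scalar multiple of the Pauli operator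
`W(v)`, and `σ` is multiplicative on `L`. -/
structure PauliSection (L : Submodule (ZMod 2) (QV P)) where
  toFun : QV P → MatP P
  scalar : ∀ v : QV P, ∃ c : ℂ, toFun v = c • Wop v
  unitary : ∀ v : QV P, toFun v ∈ Matrix.unitaryGroup (P → Fin 2) ℂ
  mul_of_mem : ∀ u ∈ L, ∀ v ∈ L, toFun (u + v) = toFun u * toFun v
  map_zero : toFun 0 = 1

/-- The stabilizer code `C(L, σ)`: the common fixed-point space of the stabilizer
group `σ(L)`. -/
def code (L : Submodule (ZMod 2) (QV P)) (σ : PauliSection L) : Submodule ℂ (HP P) where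
  carrier := {ψ | ∀ v ∈ L, σ.toFun v *ᵥ ψ = ψ}
  add_mem' := by intro a b ha hb v hv; rw [Matrix.mulVec_add, ha v hv, hb v hv]
  zero_mem' := by intro v hv; simp
  smul_mem' := by intro c a ha v hv; rw [Matrix.mulVec_smul, ha v hv]

/-- The standard section: `σ(v) = W(v)` on `L`. -/
def StandardOn (L : Submodule (ZMod 2) (QV P)) (σ : PauliSection L) : Prop :=
  ∀ v ∈ L, σ.toFun v = Wop v

/-! ### `SO(3)`, rotations, and the automorphism group of a code -/

/-- `3×3` real matrices. -/
abbrev Rot : Type := Matrix (Fin 3) (Fin 3) ℝ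

/-- `SO(3)` as a set of `3×3` real matrices. -/
def SO3 : Set Rot := {A | A * Aᵀ = 1 ∧ A.det = 1}

/-- The ordered Pauli basis (x, y, z) of traceless Hermitian `2×2` matrices. -/
def pauliBasis : Fin 3 → Matrix (Fin 2) (Fin 2) ℂ := ![sigmaX, sigmaY, sigmaZ]

/-- The image of a unitary `u ∈ U(2)` in `SO(3)` under the adjoint action on traceless
Hermitian operators (the identification `U(2)/S¹ = SO(3)`):
`u σ_j u† = Σ_i (adjRot u)_{ij} σ_i`. -/
def adjRot (u : Matrix (Fin 2) (Fin 2) ℂ) : Rot :=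
  Matrix.of fun i j =>
    (1 / 2 : ℝ) * ((pauliBasis i * u * pauliBasis j * u.conjTranspose).trace).re

/-- Rotation about the `x`-axis by angle `θ`. -/
def rotX (θ : ℝ) : Rot := !![1, 0, 0; 0, Real.cos θ, -Real.sin θ; 0, Real.sin θ, Real.cos θ]

/-- Rotation about the `y`-axis by angle `θ`. -/
def rotY (θ : ℝ) : Rot := !![Real.cos θ, 0, Real.sin θ; 0, 1, 0; -Real.sin θ, 0, Real.cos θ]

/-- Rotation about the `z`-axis by angle `θ`. -/
def rotZ (θ : ℝ) : Rot := !![Real.cos θ, -Real.sin θ, 0; Real.sin θ, Real.cos θ, 0; 0, 0, 1]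

/-- The circle group `C_x ⊆ SO(3)` of rotations about the `x`-axis. -/
def Cx : Set Rot := Set.range rotX

/-- The circle group `C_y ⊆ SO(3)` of rotations about the `y`-axis. -/
def Cy : Set Rot := Set.range rotY

/-- The circle group `C_z ⊆ SO(3)` of rotations about the `z`-axis. -/
def Cz : Set Rot := Set.range rotZ

/-- The octahedral group: the subgroup of `SO(3)` generated by the rotations by a right
angle about the three coordinate axes. -/
def octahedral : Set Rot :=
  (Submonoid.closure {rotX (π / 2), rotY (π / 2), rotZ (π / 2)} : Submonoid Rot)

/-- The infinite dihedral group `D_x ⊆ SO(3)`. -/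
def Dx : Set Rot := (Submonoid.closure (Cx ∪ {rotZ π}) : Submonoid Rot)

/-- The infinite dihedral group `D_y ⊆ SO(3)`. -/
def Dy : Set Rot := (Submonoid.closure (Cy ∪ {rotZ π}) : Submonoid Rot)

/-- The infinite dihedral group `D_z ⊆ SO(3)`. -/
def Dz : Set Rot := (Submonoid.closure (Cz ∪ {rotX π}) : Submonoid Rot)

/-- The automorphism group `A(L, σ) ⊆ SO(3)^P` of the stabilizer code `C(L, σ)`:
all families of rotations admitting a local unitary lift mapping the code into itself. -/
def autSet (L : Submodule (ZMod 2) (QV P)) (σ : PauliSection L) : Set (P → Rot) :=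
  {g | ∃ u : P → Matrix (Fin 2) (Fin 2) ℂ,
        (∀ p, u p ∈ Matrix.unitaryGroup (Fin 2) ℂ) ∧
        (∀ p, adjRot (u p) = g p) ∧
        ∀ ψ ∈ code L σ, locOp u *ᵥ ψ ∈ code L σ}

/-- The automorphism group `A(L, σ)_p` at the qubit `p`. -/
def autSetAt (L : Submodule (ZMod 2) (QV P)) (σ : PauliSection L) (p : P) : Set Rot :=
  (fun g => g p) '' autSet L σ

/-- The normal subgroup `Z(L, σ)` of automorphisms acting by a scalar on the code. -/
def zSet (L : Submodule (ZMod 2) (QV P)) (σ : PauliSection L) : Set (P → Rot) :=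
  {g | ∃ u : P → Matrix (Fin 2) (Fin 2) ℂ,
        (∀ p, u p ∈ Matrix.unitaryGroup (Fin 2) ℂ) ∧
        (∀ p, adjRot (u p) = g p) ∧
        ∃ c : ℂ, ∀ ψ ∈ code L σ, locOp u *ᵥ ψ = c • ψ}

/-! ### Restriction to subsets of qubits -/

/-- Restriction of a phase-space vector to the qubits of `S`. -/
def resQV (S : Set P) (v : QV P) : QV ↥S := fun s => v s

/-- Restriction as a linear map. -/
def resLin (S : Set P) : QV P →ₗ[ZMod 2] QV ↥S where
  toFun := resQV S
  map_add' := by intros; rfl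
  map_smul' := by intros; rfl

/-- `L_S`, regarded as a subspace of `V^S`. -/
def LSsub (L : Submodule (ZMod 2) (QV P)) (S : Set P) : Submodule (ZMod 2) (QV ↥S) :=
  Submodule.map (resLin S) (LS L S)

/-- The extension `M ⊗ 1` to `ℋ^{⊗P}` of an operator `M` on `ℋ^{⊗S}`. -/
def extendOp (S : Set P) (M : Matrix (↥S → Fin 2) (↥S → Fin 2) ℂ) : MatP P :=
  Matrix.of fun u w =>
    if ∀ p ∉ S, u p = w p then M (fun s => u s) (fun s => w s) else 0

/-- `σ'` is the restriction `σ|_{L_S}` of the section `σ` to `L_S`. -/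
def RestrictedSection (L : Submodule (ZMod 2) (QV P)) (σ : PauliSection L) (S : Set P)
    (σ' : PauliSection (LSsub L S)) : Prop :=
  ∀ v ∈ LS L S, extendOp S (σ'.toFun (resQV S v)) = σ.toFun v

/-! ### Contiguity, protected and gauge qubits, and normal forms -/

/-- Two qubits are contiguous if they are equal or `L` contains a vector supported
exactly on the pair. -/
def Contig (L : Submodule (ZMod 2) (QV P)) (p q : P) : Prop :=
  p = q ∨ ∃ v ∈ L, supp v = ({p, q} : Set P)

/-- The contiguity class of a qubit. -/
def contigClass (L : Submodule (ZMod 2) (QV P)) (p : P) : Set P := {q | Contig L p q}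

/-- The qubit `p` is protected: the projection `L → V^{{p}}` is surjective. -/
def IsProtected (L : Submodule (ZMod 2) (QV P)) (p : P) : Prop :=
  ∀ w : V, ∃ v ∈ L, v p = w

/-- The qubit `p` is of gauge type: the projection `L → V^{{p}}` has a line as image. -/
def IsGauge (L : Submodule (ZMod 2) (QV P)) (p : P) : Prop :=
  ¬ IsProtected L p ∧ ∃ v ∈ L, v p ≠ 0

/-- The subspace `⟨z_a + z_b : a ≠ b ∈ S⟩`. -/
def zspan (S : Set P) : Submodule (ZMod 2) (QV P) :=
  Submodule.span (ZMod 2) {w | ∃ a ∈ S, ∃ b ∈ S, a ≠ b ∧ w = zvec a + zvec b}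

/-- The vector `Σ_{s ∈ S} x_s`. -/
def xsumOn (S : Set P) : QV P := S.indicator fun _ => ((0 : ZMod 2), (1 : ZMod 2))

/-- Normal form of `L` (conclusion of the normalisation lemma): every contiguity class `S`
carries either `⟨z_a + z_b⟩` or `⟨z_a + z_b⟩ + ⟨Σ_{s∈S} x_s⟩`. -/
def NormalForm (L : Submodule (ZMod 2) (QV P)) : Prop :=
  ∀ p : P,
    LS L (contigClass L p) = zspan (contigClass L p) ∨
    LS L (contigClass L p) =
      zspan (contigClass L p) ⊔ Submodule.span (ZMod 2) {xsumOn (contigClass L p)}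

/-- The pair `(L, σ)` is normalised. -/
def Normalised (L : Submodule (ZMod 2) (QV P)) (σ : PauliSection L) : Prop :=
  NormalForm L ∧
  (∀ p : P, IsGauge L p → contigClass L p = {p} → ∀ v ∈ L, (v p).2 = 0) ∧
  (∀ p : P, IsProtected L p → contigClass L p = {p} →
    connectedComponentIn (autSetAt L σ p) 1 ⊆ Cz) ∧
  (∀ p : P, IsProtected L p → contigClass L p ≠ {p} →
    LS L (contigClass L p) = zspan (contigClass L p) →
    ∃ v ∈ L, ∀ s ∈ contigClass L p, v s = ((0 : ZMod 2), (1 : ZMod 2))) ∧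
  (∀ p q : P, p ≠ q → Contig L p q →
    σ.toFun (zvec p + zvec q) = Wop (zvec p + zvec q))

/-- A local symplectic family of automorphisms of `V`. -/
def IsLocalSymp (f : P → (V ≃ₗ[ZMod 2] V)) : Prop :=
  ∀ (p : P) (u v : V), omegaV (f p u) (f p v) = omegaV u v

/-- The image of `L` under a local (symplectic) transformation. -/
def mapL (L : Submodule (ZMod 2) (QV P)) (f : P → (V ≃ₗ[ZMod 2] V)) :
    Submodule (ZMod 2) (QV P) :=
  Submodule.map (LinearEquiv.piCongrRight f : QV P ≃ₗ[ZMod 2] QV P).toLinearMap L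

/-! ### Abstract group structures carried by subsets of a monoid -/

/-- The set `s` carries the structure of a solvable group. -/
structure SolvableGroupStructure (M : Type) [Monoid M] (s : Set M) where
  G : Type
  [grp : Group G]
  solv : IsSolvable G
  f : G → M
  inj : Function.Injective f
  map_mul : ∀ a b : G, f (a * b) = f a * f b
  range_eq : Set.range f = s

/-- The quotient of the group (carried by) `A` by the normal subgroup (carried by) `Z`
is a compact solvable topological (Lie) group. -/
structure CompactSolvableQuotientStructure (M : Type) [Monoid M] [TopologicalSpace M]
    (A Z : Set M) where
  G : Type
  [grp : Group G]
  [top : TopologicalSpace G]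
  [tgrp : IsTopologicalGroup G]
  cpt : CompactSpace G
  solv : IsSolvable G
  φ : M → G
  cont : ContinuousOn φ A
  map_mul' : ∀ a ∈ A, ∀ b ∈ A, φ (a * b) = φ a * φ b
  surj : ∀ y : G, ∃ a ∈ A, φ a = y
  ker : ∀ a ∈ A, (φ a = 1 ↔ a ∈ Z)

/-! ### Logical qubits and transversally realisable gates -/

/-- The standard hermitian inner product on a finite-dimensional function space. -/
def innerF {ι : Type} [Fintype ι] (ψ φ : ι → ℂ) : ℂ := ∑ i, (starRingEnd ℂ) (ψ i) * φ i

/-- `e` is a unitary identification of the code space with a space of logical qubits. -/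
def IsUnitaryEquiv (L : Submodule (ZMod 2) (QV P)) (σ : PauliSection L) {d : ℕ}
    (e : ↥(code L σ) ≃ₗ[ℂ] HP (Fin d)) : Prop :=
  ∀ ψ φ : ↥(code L σ),
    innerF (e ψ) (e φ) = innerF (ψ : HP P) (φ : HP P)

/-- The operator acting as `w` on the logical qubit `k` and trivially elsewhere. -/
def oneQubitOp (d : ℕ) (k : Fin d) (w : Matrix (Fin 2) (Fin 2) ℂ) : MatP (Fin d) :=
  locOp fun j => if j = k then w else 1

/-- The set of rotations in `SO(3)` induced, via the identification `e`, on a fixed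
logical qubit `k` by (exactly realised) transversal gates, i.e. by elements of `A(L, σ)`. -/
def logicalSet (L : Submodule (ZMod 2) (QV P)) (σ : PauliSection L) {d : ℕ}
    (e : ↥(code L σ) ≃ₗ[ℂ] HP (Fin d)) (k : Fin d) : Set Rot :=
  {A | ∃ w ∈ Matrix.unitaryGroup (Fin 2) ℂ, adjRot w = A ∧
        ∃ u : P → Matrix (Fin 2) (Fin 2) ℂ,
          (∀ p, u p ∈ Matrix.unitaryGroup (Fin 2) ℂ) ∧
          ∀ φ : HP (Fin d),
            locOp u *ᵥ ((e.symm φ : HP P)) = ((e.symm (oneQubitOp d k w *ᵥ φ) : HP P))}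

/-! ### Reed–Muller codes -/

/-- The qubit set `P = 𝔽₂^m ∖ {0}`. -/
abbrev RMQubits (m : ℕ) := {s : Fin m → ZMod 2 // s ≠ 0}

/-- Polynomial functions on `𝔽₂^m` of degree at most `r` with zero constant term. -/
def RMspan (r m : ℕ) : Submodule (ZMod 2) ((Fin m → ZMod 2) → ZMod 2) :=
  Submodule.span (ZMod 2)
    {f | ∃ I : Finset (Fin m), I.Nonempty ∧ I.card ≤ r ∧ f = fun s => ∏ i ∈ I, s i}

/-- The shortened Reed–Muller code `R_*(r, m) ⊆ 𝔽₂^P`. -/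
def RMstar (r m : ℕ) : Submodule (ZMod 2) (RMQubits m → ZMod 2) :=
  Submodule.map (LinearMap.funLeft (ZMod 2) (ZMod 2) Subtype.val) (RMspan r m)

/-- The `z`-part of a phase-space vector. -/
def zPart {P : Type} : QV P →ₗ[ZMod 2] (P → ZMod 2) where
  toFun v := fun p => (v p).1
  map_add' := by intros; rfl
  map_smul' := by intros; rfl

/-- The `x`-part of a phase-space vector. -/
def xPart {P : Type} : QV P →ₗ[ZMod 2] (P → ZMod 2) where
  toFun v := fun p => (v p).2
  map_add' := by intros; rfl
  map_smul' := by intros; rfl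

/-- The Calderbank–Shor–Steane isotropic subspace built from the shortened Reed–Muller
codes `R_*(m−2, m)` (in the `z`-coordinates) and `R_*(1, m)` (in the `x`-coordinates). -/
def cssL (m : ℕ) : Submodule (ZMod 2) (QV (RMQubits m)) :=
  Submodule.comap zPart (RMstar (m - 2) m) ⊓ Submodule.comap xPart (RMstar 1 m)

/-- The stabilizer state `|0⟩_S ⊗ |0⟩_T + |0⟩_S ⊗ |1⟩_T + |1⟩_S ⊗ |0⟩_T − |1⟩_S ⊗ |1⟩_T`
(with `T = Sᶜ`), written in the computational basis. -/
def bellLike (S : Set P) (p q : P) : HP P := fun u =>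
  if (∀ a ∈ S, u a = u p) ∧ (∀ a ∈ Sᶜ, u a = u q) then
    ((-1 : ℂ)) ^ ((u p : Fin 2).val * (u q : Fin 2).val) else 0


/-! ### Local operators and Pauli traces -/

lemma locOp_mul (g h : P → Matrix (Fin 2) (Fin 2) ℂ) :
    locOp g * locOp h = locOp fun p => g p * h p := by
  ext i j
  simp only [locOp, Matrix.mul_apply, Matrix.of_apply, Finset.prod_univ_sum, Fintype.piFinset_univ,
    Finset.prod_mul_distrib]

lemma locOp_one : locOp (fun _ : P => (1 : Matrix (Fin 2) (Fin 2) ℂ)) = 1 := by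
  ext i j
  simp only [locOp, Matrix.of_apply, Matrix.one_apply, Finset.prod_ite_zero, Finset.mem_univ,
    true_imp_iff, Finset.prod_const_one, funext_iff]

lemma locOp_conjTranspose (g : P → Matrix (Fin 2) (Fin 2) ℂ) :
    (locOp g)ᴴ = locOp fun p => (g p)ᴴ := by
  ext i j
  simp [locOp, Matrix.conjTranspose_apply]

lemma trace_locOp (g : P → Matrix (Fin 2) (Fin 2) ℂ) :
    (locOp g).trace = ∏ p, (g p).trace := by
  simp only [locOp, Matrix.trace, Matrix.diag, Matrix.of_apply, Finset.prod_univ_sum,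
    Fintype.piFinset_univ]

lemma locOp_conjTranspose_mul_self {u : P → Matrix (Fin 2) (Fin 2) ℂ}
    (hu : ∀ p, u p ∈ Matrix.unitaryGroup (Fin 2) ℂ) :
    (locOp u)ᴴ * locOp u = 1 := by
  rw [locOp_conjTranspose, locOp_mul, ← locOp_one]
  congr 1
  ext1 p
  exact Matrix.mem_unitaryGroup_iff'.mp (hu p)

lemma pauliMat_zero : pauliMat 0 = 1 := by
  simp [pauliMat]

lemma trace_pauliMat_mul_of_ne {a b : V} (h : a ≠ b) :
    (pauliMat a * pauliMat b).trace = 0 := by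
  obtain ⟨a₁, a₂⟩ := a
  obtain ⟨b₁, b₂⟩ := b
  fin_cases a₁ <;> fin_cases a₂ <;> fin_cases b₁ <;> fin_cases b₂ <;>
    simp_all [pauliMat, sigmaX, sigmaZ, Matrix.trace_fin_two, ZMod.val]

lemma trace_pauliMat_mul_self (a : V) : (pauliMat a * pauliMat a).trace ≠ 0 := by
  obtain ⟨a₁, a₂⟩ := a
  fin_cases a₁ <;> fin_cases a₂ <;>
    norm_num [pauliMat, sigmaX, sigmaZ, Matrix.trace_fin_two, ZMod.val]

lemma trace_pauliMat {a : V} (h : a ≠ 0) : (pauliMat a).trace = 0 := by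
  simpa [pauliMat_zero] using trace_pauliMat_mul_of_ne h

lemma pauliMat_z : pauliMat ((1, 0) : V) = sigmaZ := by
  simp [pauliMat, ZMod.val_one]

/-! ### The sum over the stabilizer group -/

/-- The sum of the stabilizer group, a multiple of the projector onto the code. -/
def codeSum (L : Submodule (ZMod 2) (QV P)) (σ : PauliSection L) : MatP P :=
  ∑ v with v ∈ L, σ.toFun v

lemma PauliSection.mul_codeSum {L : Submodule (ZMod 2) (QV P)} (σ : PauliSection L)
    {w : QV P} (hw : w ∈ L) : σ.toFun w * codeSum L σ = codeSum L σ := by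
  rw [codeSum, Finset.mul_sum]
  refine Finset.sum_equiv (Equiv.addLeft w) (fun v => ?_) (fun v hv => ?_)
  · simp [L.add_mem_iff_right hw]
  · rw [← σ.mul_of_mem w hw v (by simpa using hv)]
    rfl

lemma PauliSection.conjTranspose {L : Submodule (ZMod 2) (QV P)} (σ : PauliSection L)
    {w : QV P} (hw : w ∈ L) : (σ.toFun w)ᴴ = σ.toFun w := by
  have h1 : σ.toFun w * σ.toFun w = 1 := by
    rw [← σ.mul_of_mem w hw w hw, ZModModule.add_self, σ.map_zero]
  have h2 := Matrix.mem_unitaryGroup_iff'.mp (σ.unitary w)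
  exact left_inv_eq_right_inv h2 h1

lemma codeSum_conjTranspose (L : Submodule (ZMod 2) (QV P)) (σ : PauliSection L) :
    (codeSum L σ)ᴴ = codeSum L σ := by
  rw [codeSum, Matrix.conjTranspose_sum]
  exact Finset.sum_congr rfl fun v hv => σ.conjTranspose (by simpa using hv)

lemma codeSum_mulVec_mem (L : Submodule (ZMod 2) (QV P)) (σ : PauliSection L) (ψ : HP P) :
    codeSum L σ *ᵥ ψ ∈ code L σ := fun v hv => by
  rw [Matrix.mulVec_mulVec, σ.mul_codeSum hv]

lemma codeSum_mulVec_of_mem {L : Submodule (ZMod 2) (QV P)} {σ : PauliSection L} {ψ : HP P}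
    (hψ : ψ ∈ code L σ) :
    codeSum L σ *ᵥ ψ = ((Finset.univ.filter (· ∈ L)).card : ℂ) • ψ := by
  rw [codeSum, Matrix.sum_mulVec,
    Finset.sum_congr rfl fun v hv => hψ v (by simpa using hv), Finset.sum_const,
    Nat.cast_smul_eq_nsmul]

lemma codeSum_mul_mul {L : Submodule (ZMod 2) (QV P)} {σ : PauliSection L} {U : MatP P}
    (h : ∀ ψ ∈ code L σ, U *ᵥ ψ ∈ code L σ) :
    codeSum L σ * (U * codeSum L σ) =
      ((Finset.univ.filter (· ∈ L)).card : ℂ) • (U * codeSum L σ) := by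
  refine Matrix.ext_of_mulVec_single fun i => ?_
  rw [← Matrix.mulVec_mulVec, Matrix.smul_mulVec]
  refine codeSum_mulVec_of_mem ?_
  rw [← Matrix.mulVec_mulVec]
  exact h _ (codeSum_mulVec_mem L σ _)

lemma conjTranspose_mulVec_mem_code {L : Submodule (ZMod 2) (QV P)} {σ : PauliSection L}
    {U : MatP P} (hU : Uᴴ * U = 1) (h : ∀ ψ ∈ code L σ, U *ᵥ ψ ∈ code L σ) :
    ∀ ψ ∈ code L σ, Uᴴ *ᵥ ψ ∈ code L σ := by
  intro ψ hψ
  let f : code L σ →ₗ[ℂ] code L σ := U.mulVecLin.restrict h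
  have hinj : Function.Injective f := by
    intro a b hab
    have hab' : U *ᵥ (a : HP P) = U *ᵥ (b : HP P) := congrArg Subtype.val hab
    have := congrArg (Uᴴ *ᵥ ·) hab'
    simp only [Matrix.mulVec_mulVec, hU, Matrix.one_mulVec] at this
    exact Subtype.ext this
  obtain ⟨φ, hφ⟩ := LinearMap.injective_iff_surjective.mp hinj ⟨ψ, hψ⟩
  have hφ' : U *ᵥ (φ : HP P) = ψ := congrArg Subtype.val hφ
  rw [← hφ', Matrix.mulVec_mulVec, hU, Matrix.one_mulVec]
  exact φ.2

lemma mul_codeSum_comm {L : Submodule (ZMod 2) (QV P)} {σ : PauliSection L}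
    {U : MatP P} (hU : Uᴴ * U = 1) (h : ∀ ψ ∈ code L σ, U *ᵥ ψ ∈ code L σ) :
    U * codeSum L σ = codeSum L σ * U := by
  have h1 := codeSum_mul_mul h
  have h2 := congrArg Matrix.conjTranspose
    (codeSum_mul_mul (conjTranspose_mulVec_mem_code hU h))
  simp only [Matrix.conjTranspose_mul, Matrix.conjTranspose_smul, codeSum_conjTranspose,
    Matrix.conjTranspose_conjTranspose, star_natCast, Matrix.mul_assoc] at h2
  have hcard : ((Finset.univ.filter (· ∈ L)).card : ℂ) ≠ 0 := by
    rw [Nat.cast_ne_zero, Finset.card_ne_zero]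
    exact ⟨0, by simp⟩
  exact smul_right_injective _ hcard (h1.symm.trans h2)

lemma trace_codeSum_mul_locOp (L : Submodule (ZMod 2) (QV P)) (σ : PauliSection L)
    (c : QV P → ℂ) (hc : ∀ v, σ.toFun v = c v • Wop v) (N : P → Matrix (Fin 2) (Fin 2) ℂ) :
    (codeSum L σ * locOp N).trace =
      ∑ v with v ∈ L, c v * ∏ t, (pauliMat (v t) * N t).trace := by
  rw [codeSum, Finset.sum_mul, Matrix.trace_sum]
  refine Finset.sum_congr rfl fun v _ => ?_
  rw [hc, Matrix.smul_mul, Matrix.trace_smul, Wop, locOp_mul, trace_locOp, smul_eq_mul]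

lemma trace_codeSum_conj {L : Submodule (ZMod 2) (QV P)} {σ : PauliSection L}
    {U : MatP P} (hU : Uᴴ * U = 1) (h : ∀ ψ ∈ code L σ, U *ᵥ ψ ∈ code L σ) (N : MatP P) :
    (codeSum L σ * (U * N * Uᴴ)).trace = (codeSum L σ * N).trace := by
  rw [← Matrix.mul_assoc, Matrix.trace_mul_comm, ← Matrix.mul_assoc, ← Matrix.mul_assoc,
    Matrix.mul_assoc Uᴴ, ← mul_codeSum_comm hU h, ← Matrix.mul_assoc, hU, Matrix.one_mul]

lemma PauliSection.scalar_ne_zero {L : Submodule (ZMod 2) (QV P)} (σ : PauliSection L)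
    {v : QV P} {c : ℂ} (hc : σ.toFun v = c • Wop v) : c ≠ 0 := by
  rintro rfl
  have h := Matrix.mem_unitaryGroup_iff.mp (σ.unitary v)
  rw [hc, zero_smul, zero_mul] at h
  exact zero_ne_one h

/-- If all elements of `L` with the same support as `v₀` restrict to `z` at the qubit `p`, then
the automorphisms of the code preserve the `z`-axis at `p`. -/
lemma trace_sigmaZ_conj_eq_zero {L : Submodule (ZMod 2) (QV P)} {σ : PauliSection L} {p : P}
    {v₀ : QV P} (hv₀ : v₀ ∈ L) (hp : v₀ p ≠ 0)
    (hz : ∀ v ∈ L, supp v = supp v₀ → v p = (1, 0))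
    {u : P → Matrix (Fin 2) (Fin 2) ℂ} (hu : ∀ p, u p ∈ Matrix.unitaryGroup (Fin 2) ℂ)
    (h : ∀ ψ ∈ code L σ, locOp u *ᵥ ψ ∈ code L σ)
    {M : Matrix (Fin 2) (Fin 2) ℂ} (hM : M.trace = 0) (hZM : (sigmaZ * M).trace = 0) :
    (sigmaZ * ((u p)ᴴ * M * u p)).trace = 0 := by
  choose c hc using σ.scalar
  have huu : ∀ t, u t * (u t)ᴴ = 1 := fun t => Matrix.mem_unitaryGroup_iff.mp (hu t)
  have huu' : ∀ t, (u t)ᴴ * u t = 1 := fun t => Matrix.mem_unitaryGroup_iff'.mp (hu t)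
  let N : P → Matrix (Fin 2) (Fin 2) ℂ :=
    fun t => if t = p then (u p)ᴴ * M * u p else pauliMat (v₀ t)
  have hNp : N p = (u p)ᴴ * M * u p := if_pos rfl
  have hN : ∀ t, t ≠ p → N t = pauliMat (v₀ t) := fun t ht => if_neg ht
  have htr : ∀ t, v₀ t ≠ 0 → (N t).trace = 0 := by
    intro t ht
    by_cases htp : t = p
    · subst htp
      rw [hNp, Matrix.trace_mul_comm, ← Matrix.mul_assoc, huu, Matrix.one_mul, hM]
    · rw [hN t htp, trace_pauliMat ht]
  have key := trace_codeSum_conj (locOp_conjTranspose_mul_self hu) h (locOp N)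
  rw [locOp_conjTranspose, locOp_mul, locOp_mul, trace_codeSum_mul_locOp L σ c hc,
    trace_codeSum_mul_locOp L σ c hc, Finset.sum_eq_zero, Finset.sum_eq_single_of_mem v₀] at key
  · have h1 := (mul_eq_zero.mp key.symm).resolve_left (σ.scalar_ne_zero (hc v₀))
    obtain ⟨t, -, ht⟩ := Finset.prod_eq_zero_iff.mp h1
    by_cases htp : t = p
    · subst htp
      rwa [hNp, hz v₀ hv₀ rfl, pauliMat_z] at ht
    · rw [hN t htp] at ht
      exact absurd ht (trace_pauliMat_mul_self _)
  · simpa using hv₀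
  · intro v hv hne
    have hvL : v ∈ L := by simpa using hv
    obtain ⟨t, ht⟩ := Function.ne_iff.mp hne
    by_cases htp : t = p
    · subst htp
      have hs : supp v ≠ supp v₀ := fun hs => ht (by rw [hz v hvL hs, hz v₀ hv₀ rfl])
      obtain ⟨s, hs⟩ : ∃ s, ¬ (v s ≠ 0 ↔ v₀ s ≠ 0) := by
        by_contra! hcon
        exact hs (Set.ext hcon)
      by_cases hst : s = t
      · subst hst
        have hvs : v s = 0 := by tauto
        rw [Finset.prod_eq_zero (Finset.mem_univ s), mul_zero]
        rw [hvs, pauliMat_zero, Matrix.one_mul, htr s hp]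
      · rw [Finset.prod_eq_zero (Finset.mem_univ s), mul_zero]
        rw [hN s hst]
        exact trace_pauliMat_mul_of_ne fun he => hs (by rw [he])
    · rw [Finset.prod_eq_zero (Finset.mem_univ t), mul_zero]
      rw [hN t htp]
      exact trace_pauliMat_mul_of_ne ht
  · intro v hv
    have hvL : v ∈ L := by simpa using hv
    by_cases hs : supp v = supp v₀
    · rw [Finset.prod_eq_zero (Finset.mem_univ p), mul_zero]
      have hcancel : u p * N p * (u p)ᴴ = M := by
        rw [hNp, Matrix.mul_assoc, Matrix.mul_assoc, huu, Matrix.mul_one, ← Matrix.mul_assoc, huu,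
          Matrix.one_mul]
      rw [hcancel, hz v hvL hs, pauliMat_z, hZM]
    · obtain ⟨s, hs⟩ : ∃ s, ¬ (v s ≠ 0 ↔ v₀ s ≠ 0) := by
        by_contra! hcon
        exact hs (Set.ext hcon)
      rw [Finset.prod_eq_zero (Finset.mem_univ s), mul_zero]
      by_cases hv₀s : v₀ s = 0
      · have hsp : s ≠ p := fun e => hp (e ▸ hv₀s)
        rw [hN s hsp, hv₀s, pauliMat_zero, Matrix.mul_one, huu, Matrix.mul_one]
        exact trace_pauliMat (by tauto)
      · have hvs : v s = 0 := by tauto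
        rw [hvs, pauliMat_zero, Matrix.one_mul, Matrix.mul_assoc, Matrix.trace_mul_comm,
          Matrix.mul_assoc, huu', Matrix.mul_one, htr s hv₀s]

/-! ### Rotations preserving the `z`-axis -/

lemma adjRot_two_two (u : Matrix (Fin 2) (Fin 2) ℂ) :
    adjRot u 2 2 = (Complex.normSq (u 0 0) - Complex.normSq (u 0 1) - Complex.normSq (u 1 0)
      + Complex.normSq (u 1 1)) / 2 := by
  simp [adjRot, pauliBasis, sigmaZ, Matrix.trace_fin_two, Matrix.mul_apply, Fin.sum_univ_two,
    Complex.normSq_apply]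
  ring

lemma diagonal_or_antidiagonal {u : Matrix (Fin 2) (Fin 2) ℂ}
    (hu : u ∈ Matrix.unitaryGroup (Fin 2) ℂ)
    (hX : (sigmaZ * (uᴴ * sigmaX * u)).trace = 0) (hY : (sigmaZ * (uᴴ * sigmaY * u)).trace = 0) :
    (u 0 1 = 0 ∧ u 1 0 = 0) ∨ (u 0 0 = 0 ∧ u 1 1 = 0) := by
  have huu := Matrix.mem_unitaryGroup_iff.mp hu
  have h01 := congrFun (congrFun huu 0) 1
  have h00 := congrFun (congrFun huu 0) 0
  have h11 := congrFun (congrFun huu 1) 1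
  simp [Matrix.mul_apply, Fin.sum_univ_two, Matrix.star_apply] at h01 h00 h11
  simp only [Matrix.trace_fin_two, Matrix.mul_apply, Fin.sum_univ_two, Matrix.conjTranspose_apply]
    at hX hY
  simp [sigmaX, sigmaY, sigmaZ] at hX hY
  have hA : u 0 0 * conj (u 1 0) = 0 := by
    linear_combination (1 / 2 : ℂ) * h01 + (1 / 4 : ℂ) * hX - (Complex.I / 4) * hY
      + (u 0 0 * conj (u 1 0) - conj (u 0 0) * u 1 0 - u 0 1 * conj (u 1 1)
        + conj (u 0 1) * u 1 1) / 4 * Complex.I_sq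
  have hB : u 0 1 * conj (u 1 1) = 0 := by
    linear_combination h01 - hA
  rcases mul_eq_zero.mp hA with h | h
  · right
    refine ⟨h, ?_⟩
    rcases mul_eq_zero.mp hB with h' | h'
    · simp [h, h'] at h00
    · simpa using h'
  · left
    have h : u 1 0 = 0 := by simpa using h
    refine ⟨?_, h⟩
    rcases mul_eq_zero.mp hB with h' | h'
    · exact h'
    · have h' : u 1 1 = 0 := by simpa using h'
      simp [h, h'] at h11

lemma normSq_rows {u : Matrix (Fin 2) (Fin 2) ℂ} (hu : u ∈ Matrix.unitaryGroup (Fin 2) ℂ)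
    (i : Fin 2) : Complex.normSq (u i 0) + Complex.normSq (u i 1) = 1 := by
  have h := congrFun (congrFun (Matrix.mem_unitaryGroup_iff.mp hu) i) i
  simp only [Matrix.mul_apply, Fin.sum_univ_two, Matrix.star_apply, Matrix.one_apply_eq,
    RCLike.star_def, Complex.mul_conj] at h
  exact_mod_cast h

lemma adjRot_mem_Cz {u : Matrix (Fin 2) (Fin 2) ℂ} (hu : u ∈ Matrix.unitaryGroup (Fin 2) ℂ)
    (h01 : u 0 1 = 0) (h10 : u 1 0 = 0) : adjRot u ∈ Cz := by
  have h0 := normSq_rows hu 0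
  have h1 := normSq_rows hu 1
  rw [h01, map_zero, add_zero] at h0
  rw [h10, map_zero, zero_add] at h1
  set w := conj (u 0 0) * u 1 1 with hw
  have hwn : ‖w‖ = 1 := by
    rw [← sq_eq_sq₀ (norm_nonneg _) zero_le_one, Complex.sq_norm, hw, map_mul, Complex.normSq_conj,
      h0, h1]
    norm_num
  have hw0 : w ≠ 0 := by
    intro h
    simp [h] at hwn
  refine ⟨w.arg, ?_⟩
  have hcos : Real.cos w.arg = (u 0 0).re * (u 1 1).re + (u 0 0).im * (u 1 1).im := by
    rw [Complex.cos_arg hw0, hwn, div_one]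
    simp [hw]
  have hsin : Real.sin w.arg = (u 0 0).re * (u 1 1).im - (u 0 0).im * (u 1 1).re := by
    rw [Complex.sin_arg, hwn, div_one]
    simp [hw]
    ring
  rw [Complex.normSq_apply] at h0 h1
  ext i j
  fin_cases i <;> fin_cases j <;>
    simp [rotZ, hcos, hsin, adjRot, pauliBasis, sigmaX, sigmaY, sigmaZ, Matrix.trace_fin_two,
      Matrix.mul_apply, Fin.sum_univ_two, h01, h10] <;>
    linarith

/-- If all elements of `L` with the same support as `v₀` restrict to `z` at the qubit `p`, then
the identity component of the automorphism group at `p` lies in `C_z`. -/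
lemma connectedComponentIn_autSetAt_subset_Cz {L : Submodule (ZMod 2) (QV P)}
    {σ : PauliSection L} {p : P} {v₀ : QV P} (hv₀ : v₀ ∈ L) (hp : v₀ p ≠ 0)
    (hz : ∀ v ∈ L, supp v = supp v₀ → v p = (1, 0)) :
    connectedComponentIn (autSetAt L σ p) 1 ⊆ Cz := by
  have hdiag : ∀ A ∈ autSetAt L σ p,
      (A 2 2 = 1 ∧ A ∈ Cz) ∨ A 2 2 = -1 := by
    rintro _ ⟨g, ⟨u, hu, hg, hcode⟩, rfl⟩
    have hX := trace_sigmaZ_conj_eq_zero hv₀ hp hz hu hcode (M := sigmaX)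
      (by simp [sigmaX, Matrix.trace_fin_two]) (by simp [sigmaX, sigmaZ, Matrix.trace_fin_two])
    have hY := trace_sigmaZ_conj_eq_zero hv₀ hp hz hu hcode (M := sigmaY)
      (by simp [sigmaY, Matrix.trace_fin_two]) (by simp [sigmaY, sigmaZ, Matrix.trace_fin_two])
    have h0 := normSq_rows (hu p) 0
    have h1 := normSq_rows (hu p) 1
    simp only [← hg p, adjRot_two_two]
    rcases diagonal_or_antidiagonal (hu p) hX hY with ⟨h01, h10⟩ | ⟨h00, h11⟩
    · left
      refine ⟨?_, adjRot_mem_Cz (hu p) h01 h10⟩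
      rw [h01, map_zero] at h0 ⊢
      rw [h10, map_zero] at h1 ⊢
      linarith
    · right
      rw [h00, map_zero] at h0 ⊢
      rw [h11, map_zero] at h1 ⊢
      linarith
  intro A hA
  have hAF := connectedComponentIn_subset _ _ hA
  refine ((hdiag A hAF).resolve_right fun hneg => ?_).2
  have h1F : (1 : Rot) ∈ autSetAt L σ p := by
    by_contra h
    rw [connectedComponentIn_eq_empty h] at hA
    exact hA
  have hcont : ContinuousOn (fun B : Rot => B 2 2) (connectedComponentIn (autSetAt L σ p) 1) :=
    (continuous_id.matrix_elem 2 2).continuousOn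
  obtain ⟨B, hB, hB0⟩ := isPreconnected_connectedComponentIn.intermediate_value hA
    (mem_connectedComponentIn h1F) hcont
    (show (0 : ℝ) ∈ Set.Icc (A 2 2) ((1 : Rot) 2 2) by simp [hneg])
  have hB0 : B 2 2 = 0 := hB0
  rcases hdiag B (connectedComponentIn_subset _ _ hB) with ⟨h, -⟩ | h <;> norm_num [hB0] at h

/-! ### Contiguous qubits -/

lemma snd_eq_zero_of_mem_zspan {S : Set P} {v : QV P} (hv : v ∈ zspan S) (s : P) :
    (v s).2 = 0 := by
  induction hv using Submodule.span_induction with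
  | mem w hw =>
    obtain ⟨a, -, b, -, -, rfl⟩ := hw
    simp only [zvec, Pi.add_apply, Prod.snd_add, Pi.single_apply]
    split_ifs <;> simp
  | zero => rfl
  | add x y _ _ hx hy => simp [hx, hy]
  | smul c x _ hx => simp [hx]

lemma eq_z_of_snd_eq_zero {a : V} (h0 : a ≠ 0) (h : a.2 = 0) : a = (1, 0) := by
  revert a
  decide

/-- The Bell Lagrangian on two qubits `p`, `q` is a direct factor of every isotropic subspace
containing it. -/
lemma hasBellFactor_of_mem {L : Submodule (ZMod 2) (QV P)} (hL : Isotropic L) {p q : P}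
    (hpq : p ≠ q) (hz : zvec p + zvec q ∈ L) (hx : xvec p + xvec q ∈ L) : HasBellFactor L := by
  have hsupp : ∀ a : V, a ≠ 0 → supp (Pi.single p a + Pi.single q a : QV P) = {p, q} := by
    intro a ha
    ext s
    by_cases hp : s = p
    · subst hp
      simp [supp, Pi.single_apply, hpq, ha]
    · by_cases hq : s = q
      · subst hq
        simp [supp, Pi.single_apply, hp, ha]
      · simp [supp, Pi.single_apply, hp, hq]
  have homega : ∀ (a : V) (v : QV P), omega (Pi.single p a + Pi.single q a) v =
      omegaV a (v p) + omegaV a (v q) := by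
    intro a v
    have : ∀ s, omegaV ((Pi.single p a + Pi.single q a : QV P) s) (v s) =
        (if s = p then omegaV a (v p) else 0) + (if s = q then omegaV a (v q) else 0) := by
      intro s
      by_cases hp : s = p
      · subst hp
        simp [hpq]
      · by_cases hq : s = q
        · subst hq
          simp [hp]
        · simp [hp, hq, omegaV]
    rw [omega, Finset.sum_congr rfl fun s _ => this s, Finset.sum_add_distrib]
    simp
  refine ⟨p, q, hpq, fun v hv => ?_, _, hz, _, hx, fun h => ?_, hsupp _ (by decide),
    hsupp _ (by decide), ?_⟩
  · have h1 := hL _ hz v hv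
    have h2 := hL _ hx v hv
    rw [zvec, zvec, homega] at h1
    rw [xvec, xvec, homega] at h2
    have hvpq : v p = v q := by
      generalize v p = a at *
      generalize v q = b at *
      clear hv hz hx hsupp homega
      revert a b
      decide
    have hr : restrTo {p, q} v =
        (v p).1 • (zvec p + zvec q) + (v p).2 • (xvec p + xvec q) := by
      ext1 s
      by_cases hp : s = p
      · subst hp
        simp [restrTo, zvec, xvec, hpq]
      · by_cases hq : s = q
        · subst hq
          simp [restrTo, zvec, xvec, hp, hvpq]
        · simp [restrTo, zvec, xvec, hp, hq]
    rw [hr]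
    exact L.add_mem (L.smul_mem _ hz) (L.smul_mem _ hx)
  · have := congrFun h p
    simp [zvec, xvec, hpq] at this
  · have : (zvec p + zvec q + (xvec p + xvec q) : QV P) =
        Pi.single p (1, 1) + Pi.single q (1, 1) := by
      rw [add_add_add_comm, zvec, zvec, xvec, xvec, ← Pi.single_add, ← Pi.single_add]
      simp
    rw [this]
    exact hsupp _ (by decide)

lemma eq_z_of_supp_eq_pair {L : Submodule (ZMod 2) (QV P)} (hL : Isotropic L)
    (hbell : ¬ HasBellFactor L) (hnf : NormalForm L) {p q : P} (hpq : p ≠ q) {v : QV P}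
    (hv : v ∈ L) (hs : supp v = {p, q}) : v p = (1, 0) := by
  have hmem : ∀ s, v s ≠ 0 ↔ s = p ∨ s = q := fun s => Set.ext_iff.mp hs s
  have hpS : p ∈ contigClass L p := Or.inl rfl
  have hqS : q ∈ contigClass L p := Or.inr ⟨v, hv, hs⟩
  have hvS : v ∈ LS L (contigClass L p) := by
    refine ⟨hv, fun s hsS => ?_⟩
    by_contra h
    rcases (hmem s).mp h with rfl | rfl
    exacts [hsS hpS, hsS hqS]
  have hzz : zvec p + zvec q ∈ zspan (contigClass L p) :=
    Submodule.subset_span ⟨p, hpS, q, hqS, hpq, rfl⟩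
  refine eq_z_of_snd_eq_zero ((hmem p).mpr (Or.inl rfl)) ?_
  rcases hnf p with h | h
  · exact snd_eq_zero_of_mem_zspan (h ▸ hvS) p
  · have hvS' := hvS
    rw [h] at hvS'
    obtain ⟨y, hy, z, hz, rfl⟩ := Submodule.mem_sup.mp hvS'
    obtain ⟨c, rfl⟩ := Submodule.mem_span_singleton.mp hz
    have h01 : ∀ c : ZMod 2, c = 0 ∨ c = 1 := by decide
    rcases h01 c with rfl | rfl
    · simpa using snd_eq_zero_of_mem_zspan hy p
    · exfalso
      have hS : contigClass L p = {p, q} := by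
        refine Set.Subset.antisymm (fun s hsS => (hmem s).mp fun h0 => ?_) ?_
        · have := congrArg Prod.snd h0
          simp [snd_eq_zero_of_mem_zspan hy, xsumOn, hsS] at this
        · rintro s (rfl | rfl)
          exacts [hpS, hqS]
      have hzL : zvec p + zvec q ∈ LS L (contigClass L p) := by
        rw [h]
        exact Submodule.mem_sup_left hzz
      have hxL : xsumOn (contigClass L p) ∈ LS L (contigClass L p) := by
        rw [h]
        exact Submodule.mem_sup_right (Submodule.mem_span_singleton_self _)
      refine hbell (hasBellFactor_of_mem hL hpq hzL.1 ?_)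
      suffices heq : xvec p + xvec q = xsumOn (contigClass L p) from heq ▸ hxL.1
      rw [hS]
      ext1 s
      by_cases hp : s = p
      · subst hp
        simp [xsumOn, xvec, hpq]
      · by_cases hq : s = q
        · subst hq
          simp [xsumOn, xvec, hp]
        · simp [xsumOn, xvec, hp, hq]

/-- **Lemma (rotations about the `z`-axes).** If `(L, σ)` is normalised, where `L` is
an isotropic subspace free of zero, trivial, and Bell factors, then for every qubit
`p ∈ P` the connected component of the identity of `A(L, σ)_p` is contained in `C_z`. -/
theorem z_axis_lemma {P : Type} [Fintype P] [DecidableEq P]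
    (L : Submodule (ZMod 2) (QV P)) (hL : Isotropic L)
    (hzero : ¬ HasZeroFactor L) (htriv : ¬ HasTrivialFactor L)
    (hbell : ¬ HasBellFactor L)
    (σ : PauliSection L) (hnorm : Normalised L σ) (p : P) :
    connectedComponentIn (autSetAt L σ p) 1 ⊆ Cz := by
  by_cases hcls : contigClass L p = {p}
  · by_cases hprot : IsProtected L p
    · exact hnorm.2.2.1 p hprot hcls
    · obtain ⟨v₀, hv₀, hp⟩ : ∃ v ∈ L, v p ≠ 0 := by
        by_contra! h
        exact hzero ⟨{p}, Set.singleton_nonempty p, fun v hv s hs => hs ▸ h v hv⟩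
      have hline := hnorm.2.1 p ⟨hprot, v₀, hv₀, hp⟩ hcls
      refine connectedComponentIn_autSetAt_subset_Cz hv₀ hp fun v hv hs => ?_
      have hp' : p ∈ supp v := hs ▸ hp
      exact eq_z_of_snd_eq_zero hp' (hline v hv)
  · obtain ⟨q, hq, hqp⟩ : ∃ q ∈ contigClass L p, q ≠ p := by
      by_contra! h
      exact hcls (Set.eq_singleton_iff_unique_mem.mpr ⟨Or.inl rfl, h⟩)
    obtain ⟨v₀, hv₀, hs₀⟩ := hq.resolve_left hqp.symm
    have hp : p ∈ supp v₀ := hs₀ ▸ Set.mem_insert p {q}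
    exact connectedComponentIn_autSetAt_subset_Cz hv₀ hp fun v hv hs =>
      eq_z_of_supp_eq_pair hL hbell hnorm.1 hqp.symm hv (hs.trans hs₀)

end Stab
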